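/- arXiv:1411.0477 — 4 statements merged into one kernel-verified Lean document; each statement's English description precedes it below -/
import Mathlib

section
/- Let A and B be n×n complex matrices and let Ā denote the 2n×2n block upper-triangular matrix Ā = [[A, B], [0, A]] (Matrix.fromBlocks A B 0 A). For every polynomial p with complex coefficients there exists an n×n complex matrix D such that the map t ↦ p(A + t·B) (from ℂ to n×n matrices, with p evaluated via the matrix functional calculus aeval) has derivative D at t = 0, and p evaluated at Ā equals the block matrix [[p(A), D], [0, p(A)]]. -/
open Matrix Polynomial

attribute [local instance] Matrix.normedAddCommGroup Matrix.normedSpace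

/-- The product rule for matrix-valued functions of a scalar, with the entrywise sup norm. -/
theorem HasDerivAt.matrix_mul_of_supNorm {𝕜 l m n : Type*} [NontriviallyNormedField 𝕜]
    [Fintype l] [Fintype m] [Fintype n] {M : 𝕜 → Matrix l m 𝕜} {N : 𝕜 → Matrix m n 𝕜}
    {M' : Matrix l m 𝕜} {N' : Matrix m n 𝕜} {t : 𝕜}
    (hM : HasDerivAt M M' t) (hN : HasDerivAt N N' t) :
    HasDerivAt (fun s => M s * N s) (M' * N t + M t * N') t := by
  refine hasDerivAt_pi.2 fun i => hasDerivAt_pi.2 fun j => ?_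
  simp only [Matrix.add_apply, Matrix.mul_apply, ← Finset.sum_add_distrib]
  exact HasDerivAt.fun_sum fun k _ =>
    (hasDerivAt_pi.1 (hasDerivAt_pi.1 hM i) k).mul (hasDerivAt_pi.1 (hasDerivAt_pi.1 hN k) j)

/-- Polynomial case of the matrix-function derivative theorem of Mathias:
for `Ā = fromBlocks A B 0 A`, we have `p(Ā) = [[p(A), D], [0, p(A)]]` where `D` is the
derivative of `t ↦ p(A + t • B)` at `t = 0`. -/
theorem aeval_fromBlocks_eq_hasDerivAt (n : ℕ) (A B : Matrix (Fin n) (Fin n) ℂ)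
    (p : Polynomial ℂ) :
    ∃ D : Matrix (Fin n) (Fin n) ℂ,
      HasDerivAt (fun t : ℂ => Polynomial.aeval (A + t • B) p) D 0 ∧
      Polynomial.aeval (Matrix.fromBlocks A B 0 A) p =
        Matrix.fromBlocks (Polynomial.aeval A p) D 0 (Polynomial.aeval A p) := by
  induction p using Polynomial.induction_on with
  | C a =>
    refine ⟨0, ?_, ?_⟩
    · simp only [aeval_C]
      exact hasDerivAt_const (0 : ℂ) (algebraMap ℂ (Matrix (Fin n) (Fin n) ℂ) a)
    · simp [Algebra.algebraMap_eq_smul_one, ← Matrix.fromBlocks_one, Matrix.fromBlocks_smul]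
  | add p q hp hq =>
    obtain ⟨D, hD, hDA⟩ := hp
    obtain ⟨E, hE, hEA⟩ := hq
    refine ⟨D + E, ?_, ?_⟩
    · simp only [map_add]
      exact hD.fun_add hE
    · simp [hDA, hEA, Matrix.fromBlocks_add]
  | monomial k a h =>
    obtain ⟨D, hD, hDA⟩ := h
    have hline : HasDerivAt (fun t : ℂ => A + t • B) B 0 := by
      have h := ((hasDerivAt_id (0 : ℂ)).smul_const B).const_add A
      rw [one_smul] at h
      exact h
    rw [pow_succ, ← mul_assoc]
    refine ⟨D * A + Polynomial.aeval A (C a * X ^ k) * B, ?_, ?_⟩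
    · simpa only [map_mul _ _ X, aeval_X, zero_smul, add_zero] using
        hD.matrix_mul_of_supNorm hline
    · rw [map_mul _ _ X, map_mul _ _ X, hDA, aeval_X, aeval_X, Matrix.fromBlocks_multiply]
      simp [add_comm]
end

section
/- Let z be a complex number with Re(z) > 0 and define the scalar Roberts iterates by x₀ := z and x_{k+1} := (x_k + x_k⁻¹)/2. Then for every k, x_k ≠ −1 and (x_k − 1)/(x_k + 1) = ((z − 1)/(z + 1))^(2^k). -/
theorem Complex.ne_neg_one_of_re_pos {w : ℂ} (hw : 0 < w.re) : w ≠ -1 := by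
  rintro rfl
  norm_num at hw

theorem Complex.re_add_inv_div_two_pos {w : ℂ} (hw : 0 < w.re) : 0 < ((w + w⁻¹) / 2).re := by
  have hw0 : w ≠ 0 := by
    rintro rfl
    simp at hw
  have hinv : 0 < (w⁻¹).re := by
    rw [Complex.inv_re]
    exact div_pos hw (Complex.normSq_pos.mpr hw0)
  rw [Complex.div_ofNat_re, Complex.add_re]
  positivity

/-- The Cayley transform conjugates a Newton step for `X ^ 2 = 1` to squaring. -/
theorem cayley_add_inv_div_two {K : Type*} [Field K] [NeZero (2 : K)] {w : K} (hw0 : w ≠ 0) :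
    ((w + w⁻¹) / 2 - 1) / ((w + w⁻¹) / 2 + 1) = ((w - 1) / (w + 1)) ^ 2 := by
  have h2 : (2 : K) ≠ 0 := two_ne_zero
  have hsub : (w + w⁻¹) / 2 - 1 = (w - 1) ^ 2 / (2 * w) := by
    field_simp
    ring
  have hadd : (w + w⁻¹) / 2 + 1 = (w + 1) ^ 2 / (2 * w) := by
    field_simp
    ring
  rw [hsub, hadd, div_div_div_cancel_right₀ (mul_ne_zero h2 hw0), div_pow]

/-- For `Re z > 0` and the scalar Roberts iterates `x₀ = z`, `x_{k+1} = (x_k + x_k⁻¹)/2`,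
the Cayley transform satisfies `(x_k - 1)/(x_k + 1) = ((z - 1)/(z + 1))^(2^k)` and `x_k ≠ -1`. -/
theorem roberts_iter_cayley_pow (z : ℂ) (hz : 0 < z.re) (x : ℕ → ℂ) (h0 : x 0 = z)
    (hrec : ∀ k, x (k + 1) = (x k + (x k)⁻¹) / 2) :
    ∀ k, x k ≠ -1 ∧ (x k - 1) / (x k + 1) = ((z - 1) / (z + 1)) ^ (2 ^ k) := by
  have hpos : ∀ k, 0 < (x k).re := by
    intro k
    induction k with
    | zero => rwa [h0]
    | succ k ih =>
      rw [hrec]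
      exact Complex.re_add_inv_div_two_pos ih
  intro k
  refine ⟨Complex.ne_neg_one_of_re_pos (hpos k), ?_⟩
  induction k with
  | zero => simp [h0]
  | succ k ih =>
    have hk0 : x k ≠ 0 := by
      intro h
      simpa [h] using hpos k
    rw [hrec, cayley_add_inv_div_two hk0, ih, ← pow_mul, ← pow_succ]
end

section
/- Let z be a complex number with Re(z) ≠ 0 and define the scalar Roberts iterates by x₀ := z and x_{k+1} := (x_k + x_k⁻¹)/2. Then the sequence (x_k) converges, and its limit is sign(Re(z)), i.e. 1 if Re(z) > 0 and −1 if Re(z) < 0. -/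
open Filter Topology in
/-- The Cayley transform `(x - 1) / (x + 1)` conjugates the Roberts map to squaring, which gives
convergence to `1` from the open right half-plane. -/
theorem roberts_iter_tendsto_one {x : ℕ → ℂ} (h0 : 0 < (x 0).re)
    (hrec : ∀ k, x (k + 1) = (x k + (x k)⁻¹) / 2) : Tendsto x atTop (𝓝 1) := by
  have ne_of_re {w : ℂ} (h : 0 < w.re) : w ≠ 0 := by
    rintro rfl
    simp at h
  have hpos : ∀ k, 0 < (x k).re := by
    intro k
    induction k with
    | zero => exact h0
    | succ k ih =>
      have hn : 0 < Complex.normSq (x k) := Complex.normSq_pos.2 (ne_of_re ih)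
      rw [hrec, Complex.div_ofNat_re, Complex.add_re, Complex.inv_re]
      positivity
  have hne (k : ℕ) : x k ≠ 0 := ne_of_re (hpos k)
  have hne' (k : ℕ) : x k + 1 ≠ 0 :=
    ne_of_re (by simpa using add_pos (hpos k) one_pos)
  have hcayley : ∀ k, (x k - 1) / (x k + 1) = ((x 0 - 1) / (x 0 + 1)) ^ 2 ^ k := by
    intro k
    induction k with
    | zero => simp
    | succ k ih =>
      have h1 : x (k + 1) - 1 = (x k - 1) ^ 2 / (2 * x k) := by
        rw [hrec]
        field_simp [hne k]
        ring
      have h2 : x (k + 1) + 1 = (x k + 1) ^ 2 / (2 * x k) := by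
        rw [hrec]
        field_simp [hne k]
        ring
      rw [pow_succ, pow_mul, ← ih, h1, h2, div_pow,
        div_div_div_cancel_right₀ (mul_ne_zero two_ne_zero (hne k))]
  have hlt : ‖(x 0 - 1) / (x 0 + 1)‖ < 1 := by
    rw [norm_div, div_lt_one (norm_pos_iff.2 (hne' 0)), ← sq_lt_sq₀ (norm_nonneg _) (norm_nonneg _),
      Complex.sq_norm, Complex.sq_norm, Complex.normSq_apply, Complex.normSq_apply]
    simp only [Complex.sub_re, Complex.add_re, Complex.sub_im, Complex.add_im, Complex.one_re,
      Complex.one_im]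
    nlinarith
  have hw : Tendsto (fun k => (x k - 1) / (x k + 1)) atTop (𝓝 0) := by
    rw [funext hcayley]
    exact (tendsto_pow_atTop_nhds_zero_of_norm_lt_one hlt).comp
      (tendsto_pow_atTop_atTop_of_one_lt one_lt_two)
  have hx (k : ℕ) : x k = (1 + (x k - 1) / (x k + 1)) / (1 - (x k - 1) / (x k + 1)) := by
    have h1 : 1 + (x k - 1) / (x k + 1) = 2 * x k / (x k + 1) := by
      field_simp [hne' k]
      ring
    have h2 : 1 - (x k - 1) / (x k + 1) = 2 / (x k + 1) := by
      field_simp [hne' k]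
      ring
    rw [h1, h2, div_div_div_cancel_right₀ (hne' k), mul_div_cancel_left₀ _ two_ne_zero]
  have hlim := (hw.const_add 1).div (hw.const_sub 1) (by simp)
  simp only [add_zero, sub_zero, div_one] at hlim
  exact hlim.congr fun k => (hx k).symm


/-- For `Re z ≠ 0`, the scalar Roberts iterates `x₀ = z`, `x_{k+1} = (x_k + x_k⁻¹)/2`
converge to `sign (Re z)`, i.e. to `1` if `Re z > 0` and to `-1` if `Re z < 0`. -/
theorem roberts_iter_tendsto_sign (z : ℂ) (hz : z.re ≠ 0) (x : ℕ → ℂ) (h0 : x 0 = z)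
    (hrec : ∀ k, x (k + 1) = (x k + (x k)⁻¹) / 2) :
    Filter.Tendsto x Filter.atTop (nhds ((Real.sign z.re : ℝ) : ℂ)) := by
  rcases hz.lt_or_gt with h | h
  · have hneg := roberts_iter_tendsto_one (x := fun k => -x k) (by simpa [h0] using h)
      (fun k => by rw [hrec, inv_neg]; ring)
    simpa [Real.sign_of_neg h] using hneg.neg
  · simpa [Real.sign_of_pos h] using roberts_iter_tendsto_one (h0 ▸ h) hrec
end

section
/- Let A be an n×n complex matrix, let T be a k×k complex matrix that is upper Hessenberg (T i j = 0 whenever i > j + 1), let V be an n×k complex matrix, and let r ∈ ℂⁿ be such that A·V = V·T + r·e_kᵀ, where e_k is the k-th standard basis vector (rank-one residual in the last column). Then for every j ≤ k − 1, Aʲ·(V·e₁) = V·(Tʲ·e₁). Consequently, for every polynomial p of degree ≤ k − 1, p(A)·(V·e₁) = V·(p(T)·e₁). -/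
open Matrix Polynomial

/-- The first column of the `j`-th power of an upper Hessenberg matrix vanishes below row `j`. -/
theorem hessenberg_pow_mulVec_single_eq_zero {R : Type*} [Semiring R] {k : ℕ}
    {T : Matrix (Fin (k + 1)) (Fin (k + 1)) R}
    (hT : ∀ i j : Fin (k + 1), (j : ℕ) + 1 < (i : ℕ) → T i j = 0) (j : ℕ)
    (i : Fin (k + 1)) (hij : j < (i : ℕ)) :
    ((T ^ j).mulVec (Pi.single 0 1)) i = 0 := by
  induction j generalizing i with
  | zero =>
    have hi : i ≠ 0 := by
      rintro rfl
      simp at hij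
    simp [hi]
  | succ j ih =>
    rw [pow_succ', ← Matrix.mulVec_mulVec]
    rw [Matrix.mulVec, dotProduct]
    refine Finset.sum_eq_zero fun l _ => ?_
    by_cases hl : j < (l : ℕ)
    · rw [ih l hl, mul_zero]
    · rw [hT i l (by omega), zero_mul]

/-- Powers of `A` and `T` are intertwined by `V` on the first basis vector, as long as the
residual in the last column is not reached. -/
theorem krylov_pow_exactness {R : Type*} [CommSemiring R] {m : Type*} [Fintype m]
    [DecidableEq m] {k : ℕ} {A : Matrix m m R} {T : Matrix (Fin (k + 1)) (Fin (k + 1)) R}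
    (hT : ∀ i j : Fin (k + 1), (j : ℕ) + 1 < (i : ℕ) → T i j = 0)
    {V : Matrix m (Fin (k + 1)) R} {r : m → R}
    (hres : A * V = V * T + Matrix.vecMulVec r (Pi.single (Fin.last k) 1)) (j : ℕ) (hj : j ≤ k) :
    (A ^ j).mulVec (V.mulVec (Pi.single 0 1)) = V.mulVec ((T ^ j).mulVec (Pi.single 0 1)) := by
  induction j with
  | zero => simp only [pow_zero, Matrix.one_mulVec]
  | succ j ih =>
    have hlast := hessenberg_pow_mulVec_single_eq_zero hT j (Fin.last k) (by simpa using hj)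
    rw [pow_succ', ← Matrix.mulVec_mulVec, ih (by omega), Matrix.mulVec_mulVec, hres,
      Matrix.add_mulVec, Matrix.vecMulVec_mulVec, single_one_dotProduct, hlast, pow_succ' T,
      ← Matrix.mulVec_mulVec, ← Matrix.mulVec_mulVec]
    simp only [MulOpposite.op_zero, zero_smul, add_zero]

/-- Exactness of Krylov subspace approximations: if `A * V = V * T + r * e_kᵀ` with `T`
upper Hessenberg (rank-one residual in the last column), then `Aʲ (V e₁) = V (Tʲ e₁)` for all
`j ≤ k - 1`, and hence `p(A) (V e₁) = V (p(T) e₁)` for all polynomials of degree ≤ k - 1.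
(Here the matrices `T`, `V` have `k + 1` columns, `e₁` is the first and `e_{k+1}` the last
standard basis vector.) -/
theorem krylov_polynomial_exactness (n k : ℕ) (A : Matrix (Fin n) (Fin n) ℂ)
    (T : Matrix (Fin (k + 1)) (Fin (k + 1)) ℂ)
    (hT : ∀ i j : Fin (k + 1), (j : ℕ) + 1 < (i : ℕ) → T i j = 0)
    (V : Matrix (Fin n) (Fin (k + 1)) ℂ) (r : Fin n → ℂ)
    (hres : A * V = V * T + Matrix.vecMulVec r (Pi.single (Fin.last k) 1)) :
    (∀ j : ℕ, j ≤ k →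
      (A ^ j).mulVec (V.mulVec (Pi.single 0 1)) = V.mulVec ((T ^ j).mulVec (Pi.single 0 1))) ∧
    ∀ p : Polynomial ℂ, p.natDegree ≤ k →
      (Polynomial.aeval A p).mulVec (V.mulVec (Pi.single 0 1)) =
        V.mulVec ((Polynomial.aeval T p).mulVec (Pi.single 0 1)) := by
  refine ⟨krylov_pow_exactness hT hres, fun p hp => ?_⟩
  rw [Polynomial.aeval_eq_sum_range, Polynomial.aeval_eq_sum_range, Matrix.sum_mulVec,
    Matrix.sum_mulVec, Matrix.mulVec_sum]
  refine Finset.sum_congr rfl fun j hj => ?_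
  rw [Finset.mem_range] at hj
  rw [Matrix.smul_mulVec, Matrix.smul_mulVec, Matrix.mulVec_smul,
    krylov_pow_exactness hT hres j (by omega)]
end
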